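/- Let W be a classical channel from a finite alphabet 𝒳 to a finite alphabet 𝒴 and let M, M' ∈ ℕ with M' ≥ log(2)·M. Then ε^SR(W, M') ≤ ε^NS(W, M) + √2 · exp(−M'/(2M)). -/

import Mathlib

noncomputable section
open scoped BigOperators
open Classical
open scoped ComplexOrder

namespace ChannelSim

/-! ### Classical definitions -/

/-- A probability distribution on a finite type. -/
def IsProbDist {Y : Type*} [Fintype Y] (p : Y → ℝ) : Prop :=
  (∀ y, 0 ≤ p y) ∧ ∑ y, p y = 1

/-- A classical channel: a stochastic matrix, i.e. each row is a probability distribution. -/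
def IsChannel {X Y : Type*} [Fintype Y] (W : X → Y → ℝ) : Prop :=
  ∀ x, IsProbDist (W x)

/-- The `n`-fold product channel `W^{⊗n}`. -/
def prodChannel {X Y : Type*} (W : X → Y → ℝ) (n : ℕ) :
    (Fin n → X) → (Fin n → Y) → ℝ :=
  fun xs ys => ∏ i, W (xs i) (ys i)

/-- The `n`-fold product distribution `q^{⊗n}`. -/
def prodDist {Y : Type*} (q : Y → ℝ) (n : ℕ) : (Fin n → Y) → ℝ :=
  fun ys => ∏ i, q (ys i)

/-- Fidelity of probability distributions on a finite type. -/
def cFid {Y : Type*} [Fintype Y] (p q : Y → ℝ) : ℝ :=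
  (∑ y, Real.sqrt (p y * q y)) ^ 2

/-- Purified distance of probability distributions on a finite type. -/
def cPD {Y : Type*} [Fintype Y] (p q : Y → ℝ) : ℝ :=
  Real.sqrt (1 - cFid p q)

/-- Non-signaling simulation error of a classical channel with communication size `M`. -/
def cEpsNS {X Y : Type*} [Fintype X] [Fintype Y] (W : X → Y → ℝ) (M : ℝ) : ℝ :=
  sInf { e : ℝ | ∃ (W' : X → Y → ℝ) (q : Y → ℝ), IsChannel W' ∧ IsProbDist q ∧
    (∀ x y, W' x y ≤ M * q y) ∧ e = ⨆ x, cPD (W x) (W' x) }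

/-- Shared-randomness simulation error of a classical channel with communication size `M`. -/
def cEpsSR {X Y : Type*} [Fintype X] [Fintype Y] (W : X → Y → ℝ) (M : ℝ) : ℝ :=
  sInf { e : ℝ | ∃ (k m : ℕ) (pS : Fin k → ℝ) (Enc : X → Fin k → Fin m → ℝ)
    (Dec : Fin m → Fin k → Y → ℝ),
    IsProbDist pS ∧ (∀ x s, IsProbDist (Enc x s)) ∧ (∀ i s, IsProbDist (Dec i s)) ∧
    (m : ℝ) ≤ M ∧
    e = ⨆ x, cPD (W x) (fun y => ∑ s, pS s * ∑ i, Enc x s i * Dec i s y) }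

/-- Classical Rényi divergence of order `α > 0`, with values in the extended reals:
the Kullback–Leibler divergence at `α = 1`, and `+∞` whenever `α > 1` (or `α = 1`)
and the support of `p` is not contained in that of `q`. -/
def cRenyiD {Y : Type*} [Fintype Y] (α : ℝ) (p q : Y → ℝ) : EReal :=
  if α = 1 then
    (if ∀ y, q y = 0 → p y = 0 then
      ((∑ y, p y * Real.log (p y / q y) : ℝ) : EReal) else (⊤ : EReal))
  else if 1 < α ∧ ¬ (∀ y, q y = 0 → p y = 0) then (⊤ : EReal)
  else (((α - 1)⁻¹ * Real.log (∑ y, p y ^ α * q y ^ (1 - α)) : ℝ) : EReal)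

/-- Rényi mutual information `I_α(W) = inf_q sup_x D_α(W(·|x)‖q)` of a classical channel. -/
def cRenyiMI {X Y : Type*} [Fintype X] [Fintype Y] (α : ℝ) (W : X → Y → ℝ) : EReal :=
  ⨅ q : {q : Y → ℝ // IsProbDist q}, ⨆ x, cRenyiD α (W x) q.1

/-- Kullback–Leibler divergence (real-valued formula, valid on matching supports). -/
def cKL {Y : Type*} [Fintype Y] (p q : Y → ℝ) : ℝ :=
  ∑ y, p y * Real.log (p y / q y)

/-- Relative-entropy variance (real-valued formula, valid on matching supports). -/
def cVar {Y : Type*} [Fintype Y] (p q : Y → ℝ) : ℝ :=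
  (∑ y, p y * (Real.log (p y / q y)) ^ 2) - (cKL p q) ^ 2

/-- The empirical type of a word `xs ∈ X^n`. -/
def empType {X : Type*} [Fintype X] {n : ℕ} (xs : Fin n → X) : X → ℝ :=
  fun x => (Finset.univ.filter fun i => xs i = x).card / n

/-! ### Quantum definitions -/

/-- A density matrix: positive semidefinite with unit trace. -/
def IsDensity {n : Type*} [Fintype n] [DecidableEq n] (ρ : Matrix n n ℂ) : Prop :=
  ρ.PosSemidef ∧ ρ.trace = 1

/-- Functional calculus for Hermitian matrices (junk value `0` on non-Hermitian input). -/
def matFun {n : Type*} [Fintype n] [DecidableEq n] (f : ℝ → ℝ) (A : Matrix n n ℂ) :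
    Matrix n n ℂ :=
  if hA : A.IsHermitian then
    (hA.eigenvectorUnitary : Matrix n n ℂ) *
      Matrix.diagonal (fun i => ((f (hA.eigenvalues i)) : ℂ)) *
      (star (hA.eigenvectorUnitary : Matrix n n ℂ))
  else 0

/-- Fidelity of density matrices: `F(ρ,σ) = (Tr √(√ρ σ √ρ))²`. -/
def qFid {n : Type*} [Fintype n] [DecidableEq n] (ρ σ : Matrix n n ℂ) : ℝ :=
  ((matFun Real.sqrt (matFun Real.sqrt ρ * σ * matFun Real.sqrt ρ)).trace).re ^ 2

/-- Purified distance of density matrices. -/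
def qPD {n : Type*} [Fintype n] [DecidableEq n] (ρ σ : Matrix n n ℂ) : ℝ :=
  Real.sqrt (1 - qFid ρ σ)

/-- Non-signaling simulation error of a classical-quantum channel with communication size `M`. -/
def qEpsNS {X B : Type*} [Fintype X] [Fintype B] [DecidableEq B]
    (W : X → Matrix B B ℂ) (M : ℝ) : ℝ :=
  sInf { e : ℝ | ∃ (W' : X → Matrix B B ℂ) (σ : Matrix B B ℂ),
    (∀ x, IsDensity (W' x)) ∧ IsDensity σ ∧ (∀ x, (M • σ - W' x).PosSemidef) ∧
    e = ⨆ x, qPD (W x) (W' x) }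

/-- Support inclusion `supp ρ ⊆ supp σ` for positive semidefinite matrices, expressed
via kernels: every vector killed by `σ` is killed by `ρ`. -/
def suppLE {n : Type*} [Fintype n] (ρ σ : Matrix n n ℂ) : Prop :=
  ∀ v, σ.mulVec v = 0 → ρ.mulVec v = 0

/-- Umegaki relative entropy `D(ρ‖σ) = Tr ρ (log ρ − log σ)` (logarithms on supports;
real-valued formula, valid when `supp ρ ⊆ supp σ`). -/
def relEntQ {n : Type*} [Fintype n] [DecidableEq n] (ρ σ : Matrix n n ℂ) : ℝ :=
  ((ρ * (matFun Real.log ρ - matFun Real.log σ)).trace).re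

/-- Quantum relative-entropy variance `Tr ρ (log ρ − log σ)² − D(ρ‖σ)²`. -/
def varQ {n : Type*} [Fintype n] [DecidableEq n] (ρ σ : Matrix n n ℂ) : ℝ :=
  ((ρ * (matFun Real.log ρ - matFun Real.log σ) ^ 2).trace).re - (relEntQ ρ σ) ^ 2

/-- Sandwiched Rényi divergence of order `α`, valued in the extended reals:
`D̃_α(ρ‖σ) = (α−1)⁻¹ log Tr (σ^{(1−α)/(2α)} ρ σ^{(1−α)/(2α)})^α`, with the Umegaki relative
entropy at `α = 1`, and `+∞` when `α ≥ 1` and `supp ρ ⊄ supp σ`, or `α < 1` and `ρσ = 0`. -/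
def sandD {n : Type*} [Fintype n] [DecidableEq n] (α : ℝ) (ρ σ : Matrix n n ℂ) : EReal :=
  if α = 1 then (if suppLE ρ σ then ((relEntQ ρ σ : ℝ) : EReal) else (⊤ : EReal))
  else if (1 < α ∧ ¬ suppLE ρ σ) ∨ (α < 1 ∧ ρ * σ = 0) then (⊤ : EReal)
  else (((α - 1)⁻¹ * Real.log
      (((matFun (fun t => t ^ α)
        (matFun (fun t => t ^ ((1 - α) / (2 * α))) σ * ρ *
          matFun (fun t => t ^ ((1 - α) / (2 * α))) σ)).trace).re) : ℝ) : EReal)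

/-- Sandwiched Rényi mutual information `Ĩ_α(W) = inf_σ sup_x D̃_α(W_x‖σ)` of a CQ channel. -/
def sandMI {X B : Type*} [Fintype X] [Fintype B] [DecidableEq B]
    (α : ℝ) (W : X → Matrix B B ℂ) : EReal :=
  ⨅ σ : {σ : Matrix B B ℂ // IsDensity σ}, ⨆ x, sandD α (W x) σ.1

/-- `n`-fold tensor power `ρ^{⊗n}` of a matrix, realized on the index set `Fin n → B`. -/
def tensPow {B : Type*} (ρ : Matrix B B ℂ) (n : ℕ) :
    Matrix (Fin n → B) (Fin n → B) ℂ :=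
  Matrix.of fun a b => ∏ i, ρ (a i) (b i)

/-- Tensor product `V_1 ⊗ ⋯ ⊗ V_k` of a family of matrices. -/
def tensProd {B : Type*} {k : ℕ} (V : Fin k → Matrix B B ℂ) :
    Matrix (Fin k → B) (Fin k → B) ℂ :=
  Matrix.of fun a b => ∏ i, V i (a i) (b i)

/-- The `n`-fold product CQ channel `W^{⊗n}`. -/
def cqPow {X B : Type*} (W : X → Matrix B B ℂ) (n : ℕ) :
    (Fin n → X) → Matrix (Fin n → B) (Fin n → B) ℂ :=
  fun xs => Matrix.of fun a b => ∏ i, W (xs i) (a i) (b i)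

/-- Minimal positive eigenvalue of a Hermitian matrix (junk value `0` otherwise). -/
def minPosEig {n : Type*} [Fintype n] [DecidableEq n] (A : Matrix n n ℂ) : ℝ :=
  if hA : A.IsHermitian then sInf {t : ℝ | 0 < t ∧ ∃ i, hA.eigenvalues i = t} else 0

/-- Extended-real exponential, sending `⊥ = −∞` to `0`. -/
def expE (x : EReal) : ℝ := if x = ⊥ then 0 else Real.exp x.toReal


/-- The joint classical–quantum state `W∘p = Σ_x p(x) |x⟩⟨x| ⊗ W_x` as a block-diagonal
matrix on `ℂ^{|X|} ⊗ B`. -/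
def cqJoint {X B : Type*} [DecidableEq X] (p : X → ℝ) (W : X → Matrix B B ℂ) :
    Matrix (X × B) (X × B) ℂ :=
  Matrix.of fun a b => if a.1 = b.1 then (p a.1 : ℂ) * W a.1 a.2 b.2 else 0

end ChannelSim
namespace ChannelSim

lemma cFid_le_one {Y : Type*} [Fintype Y] {p w : Y → ℝ} (hp : IsProbDist p)
    (hw : IsProbDist w) : cFid p w ≤ 1 := by
  have h := Real.sum_sqrt_mul_sqrt_le Finset.univ hp.1 hw.1
  rw [hp.2, hw.2, Real.sqrt_one, mul_one] at h
  have h' : ∑ y, √(p y * w y) ≤ 1 := by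
    simpa only [Real.sqrt_mul (hp.1 _)] using h
  exact pow_le_one₀ (Finset.sum_nonneg fun _ _ => Real.sqrt_nonneg _) h'

/-- If `t` dominates `(1 - δ) w`, then passing from `w` to `t` costs at most `√δ` in purified
distance. -/
lemma cPD_le_add_sqrt {Y : Type*} [Fintype Y] {p w t : Y → ℝ} {δ : ℝ} (hp : IsProbDist p)
    (hw : IsProbDist w) (hδ : 0 ≤ δ) (hδ1 : δ ≤ 1) (h : ∀ y, (1 - δ) * w y ≤ t y) :
    cPD p t ≤ cPD p w + √δ := by
  have hF : (1 - δ) * cFid p w ≤ cFid p t := by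
    unfold cFid
    rw [← Real.sq_sqrt (sub_nonneg.2 hδ1), ← mul_pow, Finset.mul_sum]
    refine pow_le_pow_left₀ (Finset.sum_nonneg fun _ _ => by positivity)
      (Finset.sum_le_sum fun y _ => ?_) 2
    rw [← Real.sqrt_mul (sub_nonneg.2 hδ1)]
    refine Real.sqrt_le_sqrt ?_
    nlinarith [mul_le_mul_of_nonneg_left (h y) (hp.1 y)]
  have h1 := cFid_le_one hp hw
  have h0 : 0 ≤ 1 - cFid p w := sub_nonneg.2 h1
  unfold cPD
  rw [Real.sqrt_le_left (by positivity)]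
  nlinarith [Real.sq_sqrt h0, Real.sq_sqrt hδ, Real.sqrt_nonneg (1 - cFid p w),
    Real.sqrt_nonneg δ, mul_nonneg (Real.sqrt_nonneg (1 - cFid p w)) (Real.sqrt_nonneg δ)]

/-- Expectation, over independent samples of `q`, of a test `v` on the `i`-th sample and a
test `u` on all earlier ones. -/
lemma sum_prod_mul_prod_lt_mul {Y : Type*} [Fintype Y] {q : Y → ℝ} (hq : ∑ y, q y = 1)
    {n : ℕ} (u v : Y → ℝ) (i : Fin n) :
    ∑ ys : Fin n → Y, (∏ j, q (ys j)) * (v (ys i) * ∏ j with j < i, u (ys j)) =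
      (∑ y, q y * v y) * ∏ j : Fin n with j < i, ∑ y, q y * u y := by
  have key := Fintype.prod_sum
    (fun (j : Fin n) y => q y * ((if j = i then v y else 1) * if j < i then u y else 1))
  have hl : ∀ j : Fin n,
      ∑ y, q y * ((if j = i then v y else 1) * if j < i then u y else 1) =
      (if j = i then ∑ y, q y * v y else 1) * if j < i then ∑ y, q y * u y else 1 := by
    intro j
    by_cases hji : j = i
    · simp [hji]
    · by_cases hlt : j < i <;> simp [hji, hlt, hq]
  simp only [hl, Finset.prod_mul_distrib, Finset.prod_ite_eq',
    Finset.mem_univ, if_true, ← Finset.prod_filter] at key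
  rw [key]

/-- Rejection sampling: the probability that the `i`-th of `n` candidates is the first one
accepted, where all failures are assigned to the candidate `i₀`. -/
def rejectionEnc {n : ℕ} (i₀ : Fin n) (a : Fin n → ℝ) (i : Fin n) : ℝ :=
  a i * ∏ j with j < i, (1 - a j) + if i = i₀ then ∏ j, (1 - a j) else 0

lemma isProbDist_rejectionEnc {n : ℕ} (i₀ : Fin n) {a : Fin n → ℝ} (ha : ∀ i, 0 ≤ a i)
    (ha1 : ∀ i, a i ≤ 1) : IsProbDist (rejectionEnc i₀ a) := by
  have h (s : Finset (Fin n)) : 0 ≤ ∏ j ∈ s, (1 - a j) :=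
    Finset.prod_nonneg fun j _ => sub_nonneg.2 (ha1 j)
  constructor
  · intro i
    unfold rejectionEnc
    have := mul_nonneg (ha i) (h {j | j < i})
    split_ifs <;> linarith [h Finset.univ]
  · simp only [rejectionEnc, Finset.sum_add_distrib, Finset.sum_ite_eq', Finset.mem_univ, if_true]
    rw [Finset.prod_one_sub_ordered]
    ring

lemma le_rejection_sampling {Y : Type*} [Fintype Y] {q w : Y → ℝ} {M : ℝ} (hM : 1 ≤ M)
    (hq : IsProbDist q) (hw : IsProbDist w) (hwq : ∀ y, w y ≤ M * q y) {n : ℕ} (i₀ : Fin n)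
    (y : Y) :
    (1 - (1 - 1 / M) ^ n) * w y ≤ ∑ ys : Fin n → Y, (∏ j, q (ys j)) *
      ∑ i, rejectionEnc i₀ (fun j => w (ys j) / (M * q (ys j))) i *
        if ys i = y then 1 else 0 := by
  have hM0 : 0 < M := by linarith
  have hmul (z : Y) : q z * (w z / (M * q z)) = w z / M := by
    rcases eq_or_ne (q z) 0 with h | h
    · have : w z = 0 := le_antisymm (by simpa [h] using hwq z) (hw.1 z)
      simp [h, this]
    · field_simp
  have ha1 (z : Y) : w z / (M * q z) ≤ 1 :=
    div_le_one_of_le₀ (hwq z) (mul_nonneg hM0.le (hq.1 z))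
  have hu : ∑ z, q z * (1 - w z / (M * q z)) = 1 - 1 / M := by
    simp only [mul_sub, hmul, mul_one, Finset.sum_sub_distrib, hq.2, ← Finset.sum_div, hw.2]
  have hv : ∑ z, q z * (w z / (M * q z) * if z = y then 1 else 0) = w y / M := by
    simp [hmul]
  have hgeom : (1 - 1 / M) ^ n = 1 - ∑ i : Fin n, 1 / M * ∏ j : Fin n with j < i, (1 - 1 / M) := by
    rw [← Finset.prod_one_sub_ordered]; simp
  calc (1 - (1 - 1 / M) ^ n) * w y
      = ∑ i : Fin n, w y / M * ∏ j : Fin n with j < i, (1 - 1 / M) := by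
        rw [hgeom, sub_sub_cancel, Finset.sum_mul]
        exact Finset.sum_congr rfl fun i _ => by ring
    _ = ∑ i : Fin n, ∑ ys : Fin n → Y, (∏ j, q (ys j)) *
          ((w (ys i) / (M * q (ys i)) * if ys i = y then 1 else 0) *
            ∏ j with j < i, (1 - w (ys j) / (M * q (ys j)))) := by
        refine Finset.sum_congr rfl fun i _ => ?_
        rw [sum_prod_mul_prod_lt_mul hq.2 (fun z => 1 - w z / (M * q z))
          (fun z => w z / (M * q z) * if z = y then 1 else 0), hu, hv]
    _ ≤ _ := by
        rw [Finset.sum_comm]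
        refine Finset.sum_le_sum fun ys _ => ?_
        rw [← Finset.mul_sum]
        refine mul_le_mul_of_nonneg_left (Finset.sum_le_sum fun i _ => ?_)
          (Finset.prod_nonneg fun j _ => hq.1 _)
        rw [mul_right_comm]
        refine mul_le_mul_of_nonneg_right ?_ (by split_ifs <;> norm_num)
        refine le_add_of_nonneg_right ?_
        split_ifs
        · exact Finset.prod_nonneg fun j _ => sub_nonneg.2 (ha1 _)
        · exact le_rfl

lemma isProbDist_prod {Y : Type*} [Fintype Y] {q : Y → ℝ} (hq : IsProbDist q) (n : ℕ) :
    IsProbDist fun ys : Fin n → Y => ∏ j, q (ys j) := by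
  refine ⟨fun ys => Finset.prod_nonneg fun j _ => hq.1 _, ?_⟩
  rw [← Fintype.prod_sum (fun (_ : Fin n) y => q y)]
  simp [hq.2]

lemma cEpsSR_le_of_le_mul {X Y : Type*} [Fintype X] [Nonempty X] [Fintype Y]
    {W W' : X → Y → ℝ} {q : Y → ℝ} {M : ℝ} {n : ℕ} (hW : IsChannel W) (hW' : IsChannel W')
    (hq : IsProbDist q) (hM : 1 ≤ M) (hn : 0 < n) (h : ∀ x y, W' x y ≤ M * q y) :
    cEpsSR W n ≤ (⨆ x, cPD (W x) (W' x)) + √((1 - 1 / M) ^ n) := by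
  have hM0 : 0 < M := by linarith
  have hδ0 : 0 ≤ 1 - 1 / M := sub_nonneg.2 ((div_le_one hM0).2 hM)
  have hδ1 : 1 - 1 / M ≤ 1 := sub_le_self _ (by positivity)
  let e := Fintype.equivFin (Fin n → Y)
  let i₀ : Fin n := ⟨0, hn⟩
  let pS := fun s => ∏ j, q (e.symm s j)
  let Enc := fun x s => rejectionEnc i₀ (fun j => W' x (e.symm s j) / (M * q (e.symm s j)))
  let Dec := fun (i : Fin n) s (y : Y) => if e.symm s i = y then (1 : ℝ) else 0
  have hbound : cEpsSR W n ≤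
      ⨆ x, cPD (W x) (fun y => ∑ s, pS s * ∑ i, Enc x s i * Dec i s y) := by
    refine csInf_le ⟨0, ?_⟩ ⟨_, n, pS, Enc, Dec, ⟨?_, ?_⟩, ?_, ?_, le_rfl, rfl⟩
    · rintro _ ⟨k, m, pS, Enc, Dec, -, -, -, -, rfl⟩
      exact Real.iSup_nonneg fun x => Real.sqrt_nonneg _
    · exact fun s => (isProbDist_prod hq n).1 _
    · exact (Equiv.sum_comp e.symm _).trans (isProbDist_prod hq n).2
    · exact fun x s => isProbDist_rejectionEnc i₀
        (fun i => div_nonneg ((hW' x).1 _) (mul_nonneg hM0.le (hq.1 _)))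
        (fun i => div_le_one_of_le₀ (h x _) (mul_nonneg hM0.le (hq.1 _)))
    · exact fun i s => ⟨fun y => by dsimp only [Dec]; split_ifs <;> norm_num, by simp [Dec]⟩
  refine hbound.trans (ciSup_le fun x => ?_)
  refine (cPD_le_add_sqrt (hW x) (hW' x) (pow_nonneg hδ0 n) (pow_le_one₀ hδ0 hδ1) fun y => ?_).trans
    (add_le_add_left (le_ciSup (f := fun x => cPD (W x) (W' x)) (Set.finite_range _).bddAbove x) _)
  refine (le_rejection_sampling hM hq (hW' x) (h x) i₀ y).trans_eq ?_
  exact (Equiv.sum_comp e.symm fun ys : Fin n → Y => (∏ j, q (ys j)) *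
      ∑ i, rejectionEnc i₀ (fun j => W' x (ys j) / (M * q (ys j))) i *
        if ys i = y then 1 else 0).symm

end ChannelSim

open ChannelSim in
/-- rounding of non-signaling strategies to shared-randomness strategies with
enlarged communication size. -/
theorem statement13 {X Y : Type*} [Fintype X] [Nonempty X] [Fintype Y]
    (W : X → Y → ℝ) (hW : IsChannel W) (M M' : ℕ) (hM : 1 ≤ M)
    (hMM' : Real.log 2 * M ≤ (M' : ℝ)) :
    cEpsSR W M' ≤ cEpsNS W M + Real.sqrt 2 * Real.exp (-(M' : ℝ) / (2 * M)) := by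
  have hM1 : (1 : ℝ) ≤ M := by exact_mod_cast hM
  have hM0 : (0 : ℝ) < M := by linarith
  have hn : 0 < M' := by
    have : (0 : ℝ) < M' := (mul_pos (Real.log_pos one_lt_two) hM0).trans_le hMM'
    exact_mod_cast this
  have hdecay : √((1 - 1 / (M : ℝ)) ^ M') ≤ √2 * Real.exp (-(M' : ℝ) / (2 * M)) := by
    have hpow : (1 - 1 / (M : ℝ)) ^ M' ≤ Real.exp (-(M' : ℝ) / (2 * M)) ^ 2 := by
      calc (1 - 1 / (M : ℝ)) ^ M' ≤ Real.exp (-(1 / (M : ℝ))) ^ M' :=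
            pow_le_pow_left₀ (sub_nonneg.2 ((div_le_one hM0).2 hM1))
              (Real.one_sub_le_exp_neg _) _
        _ = Real.exp (-(M' : ℝ) / (2 * M)) ^ 2 := by
            rw [← Real.exp_nat_mul, ← Real.exp_nat_mul]
            congr 1
            push_cast
            field_simp
    refine (Real.sqrt_le_sqrt hpow).trans ?_
    rw [Real.sqrt_sq (Real.exp_pos _).le]
    exact le_mul_of_one_le_left (Real.exp_pos _).le (Real.one_le_sqrt.2 one_le_two)
  rw [← sub_le_iff_le_add]
  refine le_csInf ?_ ?_
  · let x₀ : X := Classical.arbitrary X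
    exact ⟨_, fun _ => W x₀, W x₀, fun _ => hW x₀, hW x₀,
      fun _ y => le_mul_of_one_le_left ((hW x₀).1 y) hM1, rfl⟩
  · rintro _ ⟨W', q, hW', hq, h, rfl⟩
    rw [sub_le_iff_le_add]
    exact (cEpsSR_le_of_le_mul hW hW' hq hM1 hn h).trans (add_le_add_right hdecay _)
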